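/- Let n ≥ 1, s ∈ (0,1), and let u(x,t) be such that for each fixed t ∈ ℝ, u(·,t) ∈ C²(ℝⁿ) ∩ L̃_{2s} and u(·,t) attains its maximum over ℝⁿ at some point x̃. Then for every r > 0, (C₀/C_{n,s})·r^{2s}·[(−Δ)^s u(x̃,t) − Δu(x̃,t)] + C₀·r^{2s}·∫_{ℝⁿ∖B_r(x̃)} u(y,t)/|x̃−y|^{n+2s} dy ≥ u(x̃,t), where C₀ = (∫_{ℝⁿ∖B₁(0)} |y|^{−(n+2s)} dy)^{−1} > 0 and C₀·r^{2s}·∫_{ℝⁿ∖B_r(x̃)} |x̃−y|^{−(n+2s)} dy = 1. -/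

import Mathlib

open MeasureTheory Filter Set

noncomputable section

/-- `ℝⁿ` as a Euclidean space. -/
abbrev En (n : ℕ) : Type := EuclideanSpace ℝ (Fin n)

/-- `HasFracLap n s Cns u x L` says that the principal value defining the fractional
Laplacian `(-Δ)ˢ u (x) = Cns · P.V. ∫ (u x - u y)/|x-y|^{n+2s} dy` exists and equals `L`. -/
def HasFracLap (n : ℕ) (s Cns : ℝ) (u : En n → ℝ) (x : En n) (L : ℝ) : Prop :=
  Tendsto
    (fun ε : ℝ =>
      Cns * ∫ y in {y : En n | ε ≤ ‖x - y‖}, (u x - u y) / ‖x - y‖ ^ ((n : ℝ) + 2 * s))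
    (nhdsWithin 0 (Set.Ioi 0)) (nhds L)

/-- The classical Laplacian `Δu(x) = ∑ ∂²u/∂xᵢ²`. -/
def lap {n : ℕ} (u : En n → ℝ) (x : En n) : ℝ :=
  ∑ i : Fin n, iteratedFDeriv ℝ 2 u x fun _ => EuclideanSpace.single i (1 : ℝ)

/-- Membership in the tail space `L_{2s}`. -/
def MemL2s (n : ℕ) (s : ℝ) (u : En n → ℝ) : Prop :=
  LocallyIntegrable u volume ∧
    Integrable (fun x : En n => u x / (1 + ‖x‖ ^ ((n : ℝ) + 2 * s))) volume

/-- The Marchaud fractional time derivative of order `α ∈ (0,1)`; for `α = 1` it is the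
classical derivative. -/
def marchaud (α : ℝ) (v : ℝ → ℝ) (t : ℝ) : ℝ :=
  if α = 1 then deriv v t
  else (α / Real.Gamma (1 - α)) * ∫ τ in Set.Iio t, (v t - v τ) / (t - τ) ^ (1 + α)

/-- Membership in the space `𝓛⁻_α(ℝ)`. -/
def MemLminus (α : ℝ) (v : ℝ → ℝ) : Prop :=
  LocallyIntegrable v volume ∧
    ∀ t : ℝ, IntegrableOn (fun τ : ℝ => v τ / (1 + |τ| ^ (1 + α))) (Set.Iio t) volume

/-- Width of a set in the direction of the coordinate `i₀`. -/
def widthLast {n : ℕ} (i₀ : Fin n) (Ω : Set (En n)) : ℝ :=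
  sSup ((fun x : En n => x i₀) '' Ω) - sInf ((fun x : En n => x i₀) '' Ω)

/-- The unit vector in the direction of the coordinate `i₀`. -/
def eDir {n : ℕ} (i₀ : Fin n) : En n := EuclideanSpace.single i₀ (1 : ℝ)

/-- The second directional derivative is nonpositive at a global maximum. -/
theorem fderiv_fderiv_apply_self_nonpos {E : Type*} [NormedAddCommGroup E] [NormedSpace ℝ E]
    {f : E → ℝ} (hf : ContDiff ℝ 2 f) {x : E} (hmax : ∀ y, f y ≤ f x) (v : E) :
    fderiv ℝ (fderiv ℝ f) x v v ≤ 0 := by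
  have hline : ∀ τ : ℝ, HasDerivAt (fun τ : ℝ => x + τ • v) v τ := fun τ => by
    simpa using ((hasDerivAt_id τ).smul_const v).const_add x
  have hfd : Differentiable ℝ f := hf.differentiable (by norm_num)
  have hfd' : Differentiable ℝ (fderiv ℝ f) :=
    (hf.fderiv_right (m := 1) (by norm_num)).differentiable (by norm_num)
  set g : ℝ → ℝ := fun τ => f (x + τ • v) with hg
  have hg' : deriv g = fun τ => fderiv ℝ f (x + τ • v) v := funext fun τ =>
    ((hfd _).hasFDerivAt.comp_hasDerivAt τ (hline τ)).deriv
  have hg'' : deriv (deriv g) 0 = fderiv ℝ (fderiv ℝ f) x v v := by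
    have h : HasDerivAt (fun τ : ℝ => fderiv ℝ f (x + τ • v))
        (fderiv ℝ (fderiv ℝ f) (x + (0 : ℝ) • v) v) 0 :=
      (hfd' (x + (0 : ℝ) • v)).hasFDerivAt.comp_hasDerivAt 0 (hline 0)
    have h' : HasDerivAt (fun τ : ℝ => fderiv ℝ f (x + τ • v) v)
        (fderiv ℝ (fderiv ℝ f) (x + (0 : ℝ) • v) v v) 0 :=
      (ContinuousLinearMap.apply ℝ ℝ v).hasFDerivAt.comp_hasDerivAt 0 h
    rw [hg', h'.deriv, zero_smul, add_zero]
  rw [← hg'']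
  by_contra! hpos
  have hgmax : ∀ τ, g τ ≤ g 0 := fun τ => by simpa [hg] using hmax (x + τ • v)
  have hlmax : IsLocalMax g 0 := Eventually.of_forall hgmax
  have hcont : ContinuousAt g 0 :=
    ((hfd _).hasFDerivAt.comp_hasDerivAt 0 (hline 0)).continuousAt
  have hlmin : IsLocalMin g 0 :=
    isLocalMin_of_deriv_deriv_pos hpos hlmax.deriv_eq_zero hcont
  have heq : g =ᶠ[nhds 0] fun _ => g 0 := by
    filter_upwards [hlmin] with τ hτ using le_antisymm (hgmax τ) hτ
  have h2 : deriv (deriv g) 0 = 0 := by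
    rw [heq.deriv.deriv_eq]
    simp
  exact hpos.ne' h2

theorem lap_nonpos_of_forall_le {n : ℕ} {f : En n → ℝ} (hf : ContDiff ℝ 2 f) {x : En n}
    (hmax : ∀ y, f y ≤ f x) : lap f x ≤ 0 :=
  Finset.sum_nonpos fun i _ => by
    rw [iteratedFDeriv_two_apply]
    exact fderiv_fderiv_apply_self_nonpos hf hmax _

theorem measurableSet_le_norm_sub {n : ℕ} (x : En n) (r : ℝ) :
    MeasurableSet {y : En n | r ≤ ‖x - y‖} :=
  (isClosed_le continuous_const (by fun_prop)).measurableSet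

/-- A function with finite weighted integral is integrable against the singular kernel away from
its singularity. -/
theorem integrableOn_div_norm_sub_rpow {n : ℕ} {p : ℝ} (hp : 0 ≤ p) {f : En n → ℝ}
    (hf : Integrable (fun y => f y / (1 + ‖y‖ ^ p))) (x : En n) {r : ℝ} (hr : 0 < r) :
    IntegrableOn (fun y => f y / ‖x - y‖ ^ p) {y | r ≤ ‖x - y‖} := by
  set M : ℝ := (1 / r) ^ p + (‖x‖ / r + 1) ^ p
  have hfm : AEStronglyMeasurable f := by
    have hc : Continuous fun y : En n => 1 + ‖y‖ ^ p :=
      continuous_const.add (continuous_norm.rpow_const fun _ => Or.inr hp)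
    refine (hf.aestronglyMeasurable.mul hc.aestronglyMeasurable).congr
      (Eventually.of_forall fun y => ?_)
    have : 0 < 1 + ‖y‖ ^ p := by positivity
    simp only [Pi.mul_apply]
    field_simp
  have hkm : Measurable fun y : En n => (‖x - y‖ ^ p)⁻¹ := by fun_prop
  refine Integrable.mono' (hf.norm.const_mul M).integrableOn ?_ ?_
  · simp only [div_eq_mul_inv]
    exact (hfm.mul hkm.aestronglyMeasurable).restrict
  · filter_upwards [ae_restrict_mem (measurableSet_le_norm_sub x r)] with y hy
    have hd : 0 < ‖x - y‖ := hr.trans_le hy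
    have h1 : 1 ≤ 1 / r * ‖x - y‖ := by
      rw [one_div_mul_eq_div, le_div_iff₀ hr, one_mul]
      exact hy
    have h2 : ‖y‖ ≤ (‖x‖ / r + 1) * ‖x - y‖ := by
      have h3 : ‖y‖ ≤ ‖x‖ + ‖x - y‖ := by
        simpa using norm_sub_le x (x - y)
      have h4 : ‖x‖ * 1 ≤ ‖x‖ * (1 / r * ‖x - y‖) := by gcongr
      calc ‖y‖ ≤ ‖x‖ * (1 / r * ‖x - y‖) + ‖x - y‖ := by linarith
        _ = _ := by ring
    have hw : 1 + ‖y‖ ^ p ≤ M * ‖x - y‖ ^ p := by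
      have h5 := Real.one_le_rpow h1 hp
      have h6 := Real.rpow_le_rpow (norm_nonneg y) h2 hp
      rw [Real.mul_rpow (by positivity) hd.le] at h5 h6
      rw [add_mul]
      exact add_le_add h5 h6
    have hq : 0 < ‖x - y‖ ^ p := Real.rpow_pos_of_pos hd p
    have hz : 0 < 1 + ‖y‖ ^ p := by positivity
    rw [norm_div, norm_div, Real.norm_of_nonneg hq.le, Real.norm_of_nonneg hz.le,
      ← mul_div_assoc, div_le_div_iff₀ hq hz]
    calc ‖f y‖ * (1 + ‖y‖ ^ p) ≤ ‖f y‖ * (M * ‖x - y‖ ^ p) := by gcongr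
      _ = _ := by ring

theorem integrable_one_div_one_add_norm_rpow {n : ℕ} {p : ℝ} (hp : (n : ℝ) < p) :
    Integrable fun y : En n => (1 : ℝ) / (1 + ‖y‖ ^ p) := by
  have hp0 : 0 < p := (Nat.cast_nonneg n).trans_lt hp
  have hint : Integrable fun y : En n => (1 + ‖y‖) ^ (-p) :=
    integrable_one_add_norm (by simpa using hp)
  have hm : Measurable fun y : En n => (1 : ℝ) / (1 + ‖y‖ ^ p) := by fun_prop
  refine (hint.const_mul (2 ^ p)).mono' hm.aestronglyMeasurable (Eventually.of_forall fun y => ?_)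
  have hz : 0 < 1 + ‖y‖ ^ p := by positivity
  have hq : 0 < (1 + ‖y‖) ^ p := by positivity
  rw [Real.norm_of_nonneg (by positivity), Real.rpow_neg (by positivity), ← div_eq_mul_inv,
    div_le_div_iff₀ hz hq, one_mul]
  rcases le_total ‖y‖ 1 with h | h
  · calc (1 + ‖y‖) ^ p ≤ 2 ^ p := Real.rpow_le_rpow (by positivity) (by linarith) hp0.le
      _ ≤ 2 ^ p * (1 + ‖y‖ ^ p) :=
        le_mul_of_one_le_right (by positivity) (by linarith [Real.rpow_nonneg (norm_nonneg y) p])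
  · calc (1 + ‖y‖) ^ p ≤ (2 * ‖y‖) ^ p :=
          Real.rpow_le_rpow (by positivity) (by linarith) hp0.le
      _ = 2 ^ p * ‖y‖ ^ p := Real.mul_rpow (by norm_num) (norm_nonneg y)
      _ ≤ 2 ^ p * (1 + ‖y‖ ^ p) := by gcongr; linarith

theorem setIntegral_one_div_norm_rpow_pos {n : ℕ} (hn : 1 ≤ n) {p : ℝ} (hp : (n : ℝ) < p) :
    0 < ∫ y in {y : En n | 1 ≤ ‖y‖}, 1 / ‖y‖ ^ p := by
  have hp0 : 0 < p := (Nat.cast_nonneg n).trans_lt hp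
  have hint := integrableOn_div_norm_sub_rpow hp0.le (integrable_one_div_one_add_norm_rpow hp)
    (0 : En n) one_pos
  simp only [zero_sub, norm_neg] at hint
  rw [setIntegral_pos_iff_support_of_nonneg_ae (Eventually.of_forall fun y => by positivity) hint]
  have hopen : IsOpen {y : En n | 1 < ‖y‖} := isOpen_lt continuous_const continuous_norm
  have hne : {y : En n | 1 < ‖y‖}.Nonempty :=
    ⟨EuclideanSpace.single ⟨0, hn⟩ (2 : ℝ), by simp⟩
  refine (hopen.measure_pos volume hne).trans_le (measure_mono fun y hy => ?_)
  have hy' : 1 < ‖y‖ := hy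
  have : 0 < ‖y‖ := one_pos.trans hy'
  exact ⟨by rw [Function.mem_support]; positivity, hy'.le⟩

theorem setIntegral_one_div_norm_sub_rpow {n : ℕ} (s : ℝ) (x : En n) {r : ℝ} (hr : 0 < r) :
    r ^ (2 * s) * ∫ y in {y : En n | r ≤ ‖x - y‖}, 1 / ‖x - y‖ ^ ((n : ℝ) + 2 * s) =
      ∫ y in {y : En n | 1 ≤ ‖y‖}, 1 / ‖y‖ ^ ((n : ℝ) + 2 * s) := by
  set p : ℝ := (n : ℝ) + 2 * s with hp
  have hm : ∀ a : ℝ, MeasurableSet {y : En n | a ≤ ‖y‖} := fun a =>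
    (isClosed_le continuous_const continuous_norm).measurableSet
  have htrans : ∫ y in {y : En n | r ≤ ‖x - y‖}, 1 / ‖x - y‖ ^ p =
      ∫ y in {y : En n | r ≤ ‖y‖}, 1 / ‖y‖ ^ p := by
    rw [← integral_indicator (measurableSet_le_norm_sub x r), ← integral_indicator (hm r),
      ← integral_sub_left_eq_self ({y : En n | r ≤ ‖y‖}.indicator fun y => 1 / ‖y‖ ^ p) volume x]
    rfl
  have hscale := Measure.integral_comp_smul_of_nonneg (volume : Measure (En n))
    ({y : En n | r ≤ ‖y‖}.indicator fun y => 1 / ‖y‖ ^ p) r (hR := hr.le)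
  have hpt : ∀ y : En n, ({y : En n | r ≤ ‖y‖}.indicator fun y => 1 / ‖y‖ ^ p) (r • y) =
      (r ^ p)⁻¹ * ({y : En n | 1 ≤ ‖y‖}.indicator fun y => 1 / ‖y‖ ^ p) y := fun y => by
    have hiff : r ≤ ‖r • y‖ ↔ 1 ≤ ‖y‖ := by
      rw [norm_smul, Real.norm_of_nonneg hr.le, le_mul_iff_one_le_right hr]
    by_cases hy : 1 ≤ ‖y‖
    · rw [indicator_of_mem (by exact hiff.2 hy), indicator_of_mem (by exact hy), norm_smul,
        Real.norm_of_nonneg hr.le, Real.mul_rpow hr.le (norm_nonneg y)]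
      simp [mul_comm]
    · rw [indicator_of_notMem (by exact fun h => hy (hiff.1 h)),
        indicator_of_notMem (by exact hy), mul_zero]
  simp only [hpt, integral_const_mul, integral_indicator (hm _), finrank_euclideanSpace,
    Fintype.card_fin, smul_eq_mul] at hscale
  have hrp : r ^ p = r ^ n * r ^ (2 * s) := by
    rw [hp, Real.rpow_add hr, Real.rpow_natCast]
  have hrn : 0 < r ^ n := by positivity
  have hrs : 0 < r ^ (2 * s) := by positivity
  rw [htrans]
  rw [hrp] at hscale
  field_simp at hscale
  linarith

theorem setIntegral_le_of_hasFracLap {n : ℕ} {s Cns : ℝ} (hCns : 0 ≤ Cns)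
    {f : En n → ℝ} {x : En n} {L : ℝ}
    (hf : ∀ ε, 0 < ε → IntegrableOn (fun y => (f x - f y) / ‖x - y‖ ^ ((n : ℝ) + 2 * s))
      {y | ε ≤ ‖x - y‖})
    (hmax : ∀ y, f y ≤ f x) (hL : HasFracLap n s Cns f x L) {r : ℝ} (hr : 0 < r) :
    Cns * ∫ y in {y : En n | r ≤ ‖x - y‖}, (f x - f y) / ‖x - y‖ ^ ((n : ℝ) + 2 * s) ≤ L := by
  refine ge_of_tendsto hL ?_
  filter_upwards [Ioo_mem_nhdsGT hr] with ε hε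
  refine mul_le_mul_of_nonneg_left (setIntegral_mono_set (hf ε hε.1) ?_ ?_) hCns
  · exact Eventually.of_forall fun y => div_nonneg (sub_nonneg.2 (hmax y)) (by positivity)
  · exact Eventually.of_forall fun y (hy : r ≤ ‖x - y‖) => hε.2.le.trans hy

/-- generalized average inequality for the mixed operator (parabolic case). -/
theorem average_inequality_parabolic
    (n : ℕ) (hn : 1 ≤ n) (s : ℝ) (hs : s ∈ Set.Ioo (0 : ℝ) 1)
    (Cns : ℝ) (hCns : 0 < Cns)
    (u : En n → ℝ → ℝ) (t : ℝ)
    (huC : ContDiff ℝ 2 fun x => u x t) (huL : MemL2s n s fun x => u x t)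
    (x0 : En n) (hmax : ∀ y, u y t ≤ u x0 t)
    (L : ℝ) (hL : HasFracLap n s Cns (fun x => u x t) x0 L)
    (C₀ : ℝ)
    (hC₀ : C₀ = (∫ y in {y : En n | 1 ≤ ‖y‖}, 1 / ‖y‖ ^ ((n : ℝ) + 2 * s))⁻¹) :
    0 < C₀ ∧
      ∀ r : ℝ, 0 < r →
        C₀ * r ^ (2 * s) *
            (∫ y in {y : En n | r ≤ ‖x0 - y‖}, 1 / ‖x0 - y‖ ^ ((n : ℝ) + 2 * s)) = 1 ∧
        u x0 t ≤ C₀ / Cns * r ^ (2 * s) * (L - lap (fun x => u x t) x0) +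
            C₀ * r ^ (2 * s) *
              ∫ y in {y : En n | r ≤ ‖x0 - y‖}, u y t / ‖x0 - y‖ ^ ((n : ℝ) + 2 * s) := by
  obtain ⟨hs0, -⟩ := hs
  have hp : (n : ℝ) < (n : ℝ) + 2 * s := by linarith
  have hp0 : 0 ≤ (n : ℝ) + 2 * s := (Nat.cast_nonneg n).trans hp.le
  have hpos := setIntegral_one_div_norm_rpow_pos hn hp
  have hC : 0 < C₀ := hC₀ ▸ inv_pos.2 hpos
  refine ⟨hC, fun r hr => ?_⟩
  have hone : C₀ * r ^ (2 * s) *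
      (∫ y in {y : En n | r ≤ ‖x0 - y‖}, 1 / ‖x0 - y‖ ^ ((n : ℝ) + 2 * s)) = 1 := by
    rw [mul_assoc, setIntegral_one_div_norm_sub_rpow s x0 hr, hC₀, inv_mul_cancel₀ hpos.ne']
  refine ⟨hone, ?_⟩
  have hlap := lap_nonpos_of_forall_le huC hmax
  have hI : ∀ ε, 0 < ε → IntegrableOn
      (fun y => u x0 t * (1 / ‖x0 - y‖ ^ ((n : ℝ) + 2 * s))) {y | ε ≤ ‖x0 - y‖} := fun ε hε =>
    (integrableOn_div_norm_sub_rpow hp0 (integrable_one_div_one_add_norm_rpow hp) x0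
      hε).const_mul _
  have hJ : ∀ ε, 0 < ε → IntegrableOn
      (fun y => u y t / ‖x0 - y‖ ^ ((n : ℝ) + 2 * s)) {y | ε ≤ ‖x0 - y‖} := fun ε hε =>
    integrableOn_div_norm_sub_rpow hp0 huL.2 x0 hε
  have hsplit : ∀ y, (u x0 t - u y t) / ‖x0 - y‖ ^ ((n : ℝ) + 2 * s) =
      u x0 t * (1 / ‖x0 - y‖ ^ ((n : ℝ) + 2 * s)) - u y t / ‖x0 - y‖ ^ ((n : ℝ) + 2 * s) :=
    fun y => by ring
  have hle := setIntegral_le_of_hasFracLap hCns.le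
    (fun ε hε => by simp only [hsplit]; exact (hI ε hε).sub (hJ ε hε)) hmax hL hr
  simp only [hsplit] at hle
  rw [integral_sub (hI r hr) (hJ r hr), integral_const_mul] at hle
  set I := ∫ y in {y : En n | r ≤ ‖x0 - y‖}, 1 / ‖x0 - y‖ ^ ((n : ℝ) + 2 * s)
  set J := ∫ y in {y : En n | r ≤ ‖x0 - y‖}, u y t / ‖x0 - y‖ ^ ((n : ℝ) + 2 * s)
  calc u x0 t = (C₀ * r ^ (2 * s) * I) * u x0 t := by rw [hone, one_mul]
    _ = C₀ / Cns * r ^ (2 * s) * (Cns * (u x0 t * I - J)) + C₀ * r ^ (2 * s) * J := by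
      field_simp
      ring
    _ ≤ _ := by
      gcongr
      linarith
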